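/- Suppose all influences are non-negative (T_{j,i} ≥ 0 for all i, j). For every price p, the pessimistic equilibrium is right-continuous in the price: q̲(p) = lim_{ε→0+} q̲(p + ε), where the limit is taken componentwise. -/

import Mathlib

open Filter Topology

/-- med{0,1,x} = max(0, min(1, x)). -/
noncomputable def med (x : ℝ) : ℝ := max 0 (min 1 x)

/-- The transfer function `f_p` of the pricing game. -/
noncomputable def transfer {ι : Type*} [Fintype ι] (a b : ι → ℝ)
    (T : Matrix ι ι ℝ) (p : ℝ) (q : ι → ℝ) : ι → ℝ :=
  fun i => med ((b i - p + ∑ j, T j i * q j) / (b i - a i))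

theorem med_monotone : Monotone med := fun _ _ h =>
  max_le_max le_rfl (min_le_min le_rfl h)

theorem continuous_med : Continuous med := by
  unfold med
  fun_prop

section Transfer

variable {ι : Type*} [Fintype ι] {a b : ι → ℝ} {T : Matrix ι ι ℝ}

/-- With non-negative influences, the transfer function is antitone in the price and monotone in
the state. -/
theorem transfer_le_transfer (hab : ∀ i, a i < b i) (hT : ∀ i j, 0 ≤ T j i)
    {p p' : ℝ} (hp : p ≤ p') {q q' : ι → ℝ} (hq : q' ≤ q) :
    transfer a b T p' q' ≤ transfer a b T p q := by
  intro i
  refine med_monotone (div_le_div_of_nonneg_right ?_ (sub_pos.2 (hab i)).le)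
  have hsum : ∑ j, T j i * q' j ≤ ∑ j, T j i * q j :=
    Finset.sum_le_sum fun j _ => mul_le_mul_of_nonneg_left (hq j) (hT i j)
  linarith

theorem monotone_transfer (hab : ∀ i, a i < b i) (hT : ∀ i j, 0 ≤ T j i) (p : ℝ) :
    Monotone (transfer a b T p) :=
  fun _ _ hq => transfer_le_transfer hab hT le_rfl hq

theorem monotone_iterate_transfer_zero (hab : ∀ i, a i < b i) (hT : ∀ i j, 0 ≤ T j i) (p : ℝ) :
    Monotone fun m : ℕ => (transfer a b T p)^[m] fun _ => 0 :=
  (monotone_transfer hab hT p).monotone_iterate_of_le_map fun _ => le_max_left _ _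

theorem antitone_iterate_transfer (hab : ∀ i, a i < b i) (hT : ∀ i j, 0 ≤ T j i) (q : ι → ℝ)
    (m : ℕ) : Antitone fun p : ℝ => (transfer a b T p)^[m] q := by
  intro p p' hp
  exact (monotone_transfer hab hT p').iterate_le_of_le
    (fun _ => transfer_le_transfer hab hT hp le_rfl) m q

theorem continuous_iterate_transfer (a b : ι → ℝ) (T : Matrix ι ι ℝ) (q : ι → ℝ) (m : ℕ) :
    Continuous fun p : ℝ => (transfer a b T p)^[m] q := by
  induction m with
  | zero => exact continuous_const
  | succ m ih =>
    simp only [Function.iterate_succ_apply']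
    refine continuous_pi fun i => continuous_med.comp (Continuous.div_const ?_ _)
    have hcoord := continuous_pi_iff.1 ih
    fun_prop

end Transfer

/-- with non-negative influences, the pessimistic equilibrium is
right-continuous in the price: `q̲(p) = lim_{ε→0⁺} q̲(p+ε)` componentwise. -/
theorem pessimistic_right_continuous (n : ℕ) (a b : Fin n → ℝ)
    (T : Matrix (Fin n) (Fin n) ℝ)
    (ha : ∀ i, 0 ≤ a i) (hab : ∀ i, a i < b i)
    (hTdiag : ∀ i, T i i = 0) (hTnn : ∀ i j, 0 ≤ T j i)
    (qlow : ℝ → Fin n → ℝ)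
    (hqlow : ∀ p i, Tendsto (fun m : ℕ => (transfer a b T p)^[m] (fun _ => 0) i)
      atTop (𝓝 (qlow p i)))
    (p : ℝ) :
    ∀ i, Tendsto (fun ε : ℝ => qlow (p + ε) i) (𝓝[>] 0) (𝓝 (qlow p i)) := by
  intro i
  have hshift : Tendsto (fun ε : ℝ => p + ε) (𝓝[>] 0) (𝓝 p) := by
    have h : Tendsto (fun ε : ℝ => p + ε) (𝓝 0) (𝓝 (p + 0)) := tendsto_const_nhds.add tendsto_id
    rw [add_zero] at h
    exact h.mono_left nhdsWithin_le_nhds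
  refine tendsto_order.2 ⟨fun c hc => ?_, fun c hc => ?_⟩
  · obtain ⟨m, hm⟩ := ((hqlow p i).eventually_const_lt hc).exists
    have hcont := (continuous_apply i).comp (continuous_iterate_transfer a b T (fun _ => 0) m)
    filter_upwards [((hcont.tendsto p).comp hshift).eventually_const_lt hm] with ε hε
    exact hε.trans_le (Monotone.ge_of_tendsto
      (fun _ _ h => monotone_iterate_transfer_zero hab hTnn (p + ε) h i) (hqlow (p + ε) i) m)
  · filter_upwards [self_mem_nhdsWithin] with ε hε
    refine lt_of_le_of_lt (le_of_tendsto_of_tendsto' (hqlow (p + ε) i) (hqlow p i) fun m => ?_) hc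
    exact antitone_iterate_transfer hab hTnn _ m (le_add_of_nonneg_right (le_of_lt hε)) i
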